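/- Weak functional representation theorem with finite depth: let D be a Borel data structure over ℕ with depth(D) = k < ∞, and let μ be an exchangeable law on D. Then there exists a unif(R^k)-almost-sure natural transformation η : R^k → D such that μ = unif(R^k) ∘ η^{-1}, where R^k is the depth-k uniform randomizer with R^k_a = [0,1]^{Binom(a,≤k)} and unif(R^k)_a the product of Uniform[0,1] over the subsets of a of size at most k. -/

import Mathlib

open MeasureTheory ProbabilityTheory

/-- A Borel data structure over `ℕ`: for every finite set `a ⊆ ℕ` a standard Borel
space `obj a`, and contravariantly for every injection `τ : b → a` of finite subsets
of `ℕ` a measurable restriction map `map τ : obj a → obj b`, functorially. -/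
structure BDS where
  obj : Finset ℕ → Type
  mss : ∀ a : Finset ℕ, MeasurableSpace (obj a)
  sbs : ∀ a : Finset ℕ, @StandardBorelSpace (obj a) (mss a)
  map : ∀ {b a : Finset ℕ}, (↥b ↪ ↥a) → obj a → obj b
  map_id : ∀ a : Finset ℕ, map (Function.Embedding.refl ↥a) = id
  map_comp : ∀ {c b a : Finset ℕ} (σ : ↥c ↪ ↥b) (τ : ↥b ↪ ↥a),
    map (σ.trans τ) = map σ ∘ map τ
  map_measurable : ∀ {b a : Finset ℕ} (τ : ↥b ↪ ↥a),
    @Measurable _ _ (mss a) (mss b) (map τ)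

attribute [instance] BDS.mss BDS.sbs

/-- The inclusion embedding `↥b ↪ ↥a` associated to `b ⊆ a`. -/
def inclEmb {b a : Finset ℕ} (h : b ⊆ a) : ↥b ↪ ↥a :=
  ⟨fun i => ⟨i.1, h i.2⟩, fun i j hij => by
    rcases i with ⟨i, hi⟩; rcases j with ⟨j, hj⟩; simpa using hij⟩

/-- An exchangeable law on a Borel data structure: a probability measure on each
`obj a`, compatible with all restriction maps. -/
structure ExchLaw (D : BDS) where
  law : ∀ a : Finset ℕ, Measure (D.obj a)
  prob : ∀ a : Finset ℕ, IsProbabilityMeasure (law a)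
  exch : ∀ {b a : Finset ℕ} (τ : ↥b ↪ ↥a), Measure.map (D.map τ) (law a) = law b

/-- A (true) natural transformation of Borel data structures. -/
structure NT (D E : BDS) where
  app : ∀ a : Finset ℕ, D.obj a → E.obj a
  meas : ∀ a : Finset ℕ, Measurable (app a)
  natural : ∀ {b a : Finset ℕ} (τ : ↥b ↪ ↥a) (x : D.obj a),
    app b (D.map τ x) = E.map τ (app a x)

/-- A `ν`-almost-sure natural transformation of Borel data structures. -/
structure ASNatTrans (D E : BDS) (ν : ∀ a : Finset ℕ, Measure (D.obj a)) where
  app : ∀ a : Finset ℕ, D.obj a → E.obj a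
  meas : ∀ a : Finset ℕ, Measurable (app a)
  natural : ∀ {b a : Finset ℕ} (τ : ↥b ↪ ↥a),
    ∀ᵐ x ∂(ν a), app b (D.map τ x) = E.map τ (app a x)
/-- The uniform distribution on `[0,1]`. -/
noncomputable def unifMeas : Measure ℝ := volume.restrict (Set.Icc 0 1)

/-- The uniform randomizer `R`: the Borel data structure `a ↦ [0,1]^(2^a)` with
restriction `u ↦ u ∘ im(τ)`. -/
def RR : BDS where
  obj a := Finset ↥a → ℝ
  mss _ := inferInstance
  sbs _ := inferInstance
  map τ u := fun s => u (s.map τ)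
  map_id a := by funext u s; simp
  map_comp σ τ := by funext u s; simp [Finset.map_map]
  map_measurable τ := measurable_pi_lambda _ fun s => measurable_pi_apply _

/-- The exchangeable law `unif(R)`: on each `[0,1]^(2^a)` the product of
Uniform[0,1] measures over `2^a`. -/
noncomputable def unifRLaw : ∀ a : Finset ℕ, Measure (RR.obj a) :=
  fun a => Measure.pi fun _ : Finset ↥a => unifMeas

/-- The subsets of `a` of cardinality at most `k`. -/
abbrev SmallSets (a : Finset ℕ) (k : ℕ) : Type := {s : Finset ↥a // s.card ≤ k}

/-- The depth-`k` uniform randomizer `R^k`: the Borel data structure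
`a ↦ [0,1]^(Binom(a,≤k))` with restriction `u ↦ u ∘ im(τ)`. -/
def Rk (k : ℕ) : BDS where
  obj a := SmallSets a k → ℝ
  mss _ := inferInstance
  sbs _ := inferInstance
  map τ u := fun s => u ⟨s.val.map τ, by rw [Finset.card_map]; exact s.prop⟩
  map_id a := by
    funext u s
    exact congrArg u (Subtype.ext (by simp))
  map_comp σ τ := by
    funext u s
    exact congrArg u (Subtype.ext (by simp [Finset.map_map]))
  map_measurable τ := measurable_pi_lambda _ fun s => measurable_pi_apply _

/-- The exchangeable law `unif(R^k)`: on each `[0,1]^(Binom(a,≤k))` the product of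
Uniform[0,1] measures. -/
noncomputable def unifRkLaw (k : ℕ) : ∀ a : Finset ℕ, Measure ((Rk k).obj a) :=
  fun a => Measure.pi fun _ : SmallSets a k => unifMeas

/-- `D` is `k`-determined: elements of any `D_a` are distinguished by their
restrictions to subsets of size at most `k`. -/
def kDetermined (D : BDS) (k : ℕ) : Prop :=
  ∀ (a : Finset ℕ) (x y : D.obj a),
    (∀ (a' : Finset ℕ) (h : a' ⊆ a), a'.card ≤ k →
      D.map (inclEmb h) x = D.map (inclEmb h) y) → x = y

instance isProbabilityMeasure_unifMeas : IsProbabilityMeasure unifMeas :=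
  ⟨by simp [unifMeas]⟩

instance nullSingletonClass_unifMeas : NullSingletonClass unifMeas := by
  unfold unifMeas; infer_instance

/-- Every Markov kernel into a standard Borel space is the image of `unifMeas` under a jointly
measurable map. -/
theorem exists_measurable_map_unifMeas_eq {α β : Type*} [MeasurableSpace α] [MeasurableSpace β]
    [StandardBorelSpace β] [Nonempty β] (κ : Kernel α β) [IsMarkovKernel κ] :
    ∃ f : α → ℝ → β, Measurable (Function.uncurry f) ∧ ∀ x, Measure.map (f x) unifMeas = κ x := by
  obtain ⟨f, hf, hκ⟩ := Kernel.exists_measurable_map_eq_unitInterval κ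
  have hp : Measurable (Set.projIcc (0 : ℝ) 1 zero_le_one) := continuous_projIcc.measurable
  refine ⟨fun x u => f x (Set.projIcc 0 1 zero_le_one u), ?_, fun x => ?_⟩
  · exact hf.comp (measurable_fst.prodMk (hp.comp measurable_snd))
  · have hfx : Measurable (f x) := hf.comp measurable_prodMk_left
    have h : Measure.map (Set.projIcc (0 : ℝ) 1 zero_le_one) unifMeas = volume := by
      have : unifMeas = Measure.map ((↑) : unitInterval → ℝ) volume :=
        unitInterval.measurePreserving_coe.map_eq.symm
      rw [this, Measure.map_map hp measurable_subtype_coe]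
      convert Measure.map_id using 2
      ext u
      simp
    rw [← hκ x, ← h, Measure.map_map hfx hp]
    rfl

/-- If `V` is uniform and independent of `A`, then `f (h A) V`, where `f` codes the kernel `κ`,
has conditional law `κ (h A)` given `A`. -/
theorem map_prodMk_eq_compProd_comap {Ω α β γ : Type*} [MeasurableSpace Ω] [MeasurableSpace α]
    [MeasurableSpace β] [MeasurableSpace γ] {Q : Measure Ω} [IsProbabilityMeasure Q]
    {A : Ω → α} {V : Ω → ℝ} (hA : Measurable A) (hV : Measurable V) (hAV : IndepFun A V Q)
    (hVu : Measure.map V Q = unifMeas) {κ : Kernel γ β} [IsMarkovKernel κ] {f : γ → ℝ → β}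
    (hf : Measurable (Function.uncurry f)) (hκ : ∀ x, Measure.map (f x) unifMeas = κ x)
    {h : α → γ} (hh : Measurable h) :
    Measure.map (fun ω => (A ω, f (h (A ω)) (V ω))) Q = Measure.map A Q ⊗ₘ κ.comap h hh := by
  have hAVm := (indepFun_iff_map_prod_eq_prod_map_map hA.aemeasurable hV.aemeasurable).1 hAV
  have : IsProbabilityMeasure (Measure.map A Q) := Measure.isProbabilityMeasure_map hA.aemeasurable
  have hg : Measurable fun p : α × ℝ => (p.1, f (h p.1) p.2) :=
    measurable_fst.prodMk (hf.comp ((hh.comp measurable_fst).prodMk measurable_snd))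
  have h1 : Measure.map (fun ω => (A ω, f (h (A ω)) (V ω))) Q
      = Measure.map (fun p : α × ℝ => (p.1, f (h p.1) p.2)) ((Measure.map A Q).prod unifMeas) := by
    rw [← hVu, ← hAVm, Measure.map_map hg (hA.prodMk hV)]
    rfl
  rw [h1]
  ext s hs
  rw [Measure.map_apply hg hs, Measure.prod_apply (hg hs), Measure.compProd_apply hs]
  refine lintegral_congr fun x => ?_
  have hfx : Measurable (f (h x)) := hf.comp measurable_prodMk_left
  rw [Kernel.comap_apply, ← hκ, Measure.map_apply hfx (measurable_prodMk_left hs)]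
  rfl

theorem integral_sub_sq_eq {Ω : Type*} [MeasurableSpace Ω] {P : Measure Ω} {g h : Ω → ℝ}
    (hg : MemLp g 2 P) (hh : MemLp h 2 P) :
    ∫ ω, (g ω - h ω) ^ 2 ∂P
      = ∫ ω, g ω * g ω ∂P - 2 * ∫ ω, g ω * h ω ∂P + ∫ ω, h ω * h ω ∂P := by
  have igg : Integrable (fun ω => g ω * g ω) P := hg.integrable_mul hg
  have igh : Integrable (fun ω => 2 * (g ω * h ω)) P := (hg.integrable_mul hh).const_mul 2
  have ihh : Integrable (fun ω => h ω * h ω) P := hh.integrable_mul hh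
  have igs : Integrable (fun ω => g ω * g ω - 2 * (g ω * h ω)) P := igg.sub igh
  rw [← integral_const_mul, ← integral_sub igg igh, ← integral_add igs ihh]
  refine integral_congr_ae (.of_forall fun ω => ?_)
  simp only []
  ring

theorem integral_mul_condExp_eq {Ω : Type*} {m m0 : MeasurableSpace Ω} {P : Measure Ω}
    [IsProbabilityMeasure P] (hm : m ≤ m0) {φ W : Ω → ℝ} (hφ : StronglyMeasurable[m] φ)
    (hφL : MemLp φ 2 P) (hW : MemLp W 2 P) :
    ∫ ω, φ ω * (P[W | m]) ω ∂P = ∫ ω, φ ω * W ω ∂P := by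
  rw [← integral_condExp hm (f := fun ω => φ ω * W ω)]
  exact integral_congr_ae (condExp_mul_of_stronglyMeasurable_left hφ (hφL.integrable_mul hW)
    (hW.integrable one_le_two)).symm

/-- If a measure preserving map fixes `W` and pulls the `σ`-algebra `mZ` back into the smaller
`σ`-algebra `mH`, then `W` has the same conditional expectation given `mZ` and given `mH`. -/
theorem condExp_ae_eq_of_measurePreserving {Ω : Type*} {mH mZ m0 : MeasurableSpace Ω}
    {P : Measure Ω} [IsProbabilityMeasure P] {T : Ω → Ω} (hT : MeasurePreserving T P P)
    (hHZ : mH ≤ mZ) (hZ : mZ ≤ m0) (hTZ : mZ.comap T ≤ mH)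
    {W : Ω → ℝ} (hW : MemLp W 2 P) (hWT : W ∘ T = W) :
    P[W | mZ] =ᵐ[P] P[W | mH] := by
  set g := P[W | mZ]
  set h := P[W | mH]
  have hH := hHZ.trans hZ
  have hgL : MemLp g 2 P := hW.condExp one_le_two
  have hhL : MemLp h 2 P := hW.condExp one_le_two
  have hgTL : MemLp (g ∘ T) 2 P := hgL.comp_measurePreserving hT
  have hgm : StronglyMeasurable[mZ] g := stronglyMeasurable_condExp
  have hhm : StronglyMeasurable[mH] h := stronglyMeasurable_condExp
  have hgTm : StronglyMeasurable[mH] (g ∘ T) :=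
    (hgm.measurable.comp (Measurable.of_comap_le hTZ)).stronglyMeasurable
  have hgg : ∫ ω, g ω * g ω ∂P = ∫ ω, g ω * W ω ∂P := integral_mul_condExp_eq hZ hgm hgL hW
  have hhg : ∫ ω, h ω * g ω ∂P = ∫ ω, h ω * W ω ∂P :=
    integral_mul_condExp_eq hZ (hhm.mono hHZ) hhL hW
  have hhh : ∫ ω, h ω * h ω ∂P = ∫ ω, h ω * W ω ∂P := integral_mul_condExp_eq hH hhm hhL hW
  have hTh : ∫ ω, (g ∘ T) ω * h ω ∂P = ∫ ω, (g ∘ T) ω * W ω ∂P :=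
    integral_mul_condExp_eq hH hgTm hgTL hW
  have hTW : ∫ ω, (g ∘ T) ω * W ω ∂P = ∫ ω, g ω * W ω ∂P := by
    have hm : AEStronglyMeasurable (fun ω => g ω * W ω) (Measure.map T P) := by
      rw [hT.map_eq]
      exact (hgL.integrable_mul hW).aestronglyMeasurable
    conv_rhs => rw [← hT.map_eq, integral_map hT.measurable.aemeasurable hm]
    refine integral_congr_ae (.of_forall fun ω => ?_)
    change g (T ω) * W ω = g (T ω) * (W ∘ T) ω
    rw [hWT]
  have hTT : ∫ ω, (g ∘ T) ω * (g ∘ T) ω ∂P = ∫ ω, g ω * g ω ∂P := by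
    have hm : AEStronglyMeasurable (fun ω => g ω * g ω) (Measure.map T P) := by
      rw [hT.map_eq]
      exact (hgL.integrable_mul hgL).aestronglyMeasurable
    conv_rhs => rw [← hT.map_eq, integral_map hT.measurable.aemeasurable hm]
    rfl
  have h0 : 0 ≤ ∫ ω, ((g ∘ T) ω - h ω) ^ 2 ∂P := integral_nonneg fun ω => sq_nonneg _
  have h1 := integral_sub_sq_eq hgTL hhL
  have h2 := integral_sub_sq_eq hhL hgL
  have h3 : ∫ ω, (h ω - g ω) ^ 2 ∂P = 0 :=
    le_antisymm (by linarith) (integral_nonneg fun ω => sq_nonneg _)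
  have h4 := (integral_eq_zero_iff_of_nonneg (fun ω => sq_nonneg _)
    (hhL.sub hgL).integrable_sq).1 h3
  filter_upwards [h4] with ω hω
  have : h ω - g ω = 0 := by simpa using hω
  linarith

/-! ### Infinite structures -/

/-- An embedding of `c` into `ℕ` with values below `N`, seen as an embedding into `range N`. -/
def rangeEmb {c : Finset ℕ} (e : ↥c ↪ ℕ) (N : ℕ) (h : ∀ i, e i < N) : ↥c ↪ ↥(Finset.range N) :=
  ⟨fun i => ⟨e i, Finset.mem_range.2 (h i)⟩, fun i j hij => e.injective (by simpa using hij)⟩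

/-- The inclusion of a finite set into `ℕ`. -/
def valEmb (c : Finset ℕ) : ↥c ↪ ℕ := Function.Embedding.subtype _

/-- The elements of `D_ℕ`: compatible sequences of elements of `D_{range n}`. -/
abbrev BDS.Limit (D : BDS) : Type :=
  {ω : ∀ n, D.obj (Finset.range n) //
    ∀ n, D.map (inclEmb (Finset.range_subset_range.2 n.le_succ)) (ω (n + 1)) = ω n}

namespace BDS.Limit

variable {D : BDS}

theorem measurableSet_compatible : MeasurableSet {ω : ∀ n, D.obj (Finset.range n) |
    ∀ n, D.map (inclEmb (Finset.range_subset_range.2 n.le_succ)) (ω (n + 1)) = ω n} := by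
  rw [Set.ofPred_forall]
  exact MeasurableSet.iInter fun n =>
    measurableSet_eq_fun ((D.map_measurable _).comp (measurable_pi_apply _)) (measurable_pi_apply _)

instance : StandardBorelSpace D.Limit := measurableSet_compatible.standardBorel

/-- The restriction of `ω` to `range n`. -/
def toFun (ω : D.Limit) (n : ℕ) : D.obj (Finset.range n) := ω.1 n

theorem measurable_toFun (n : ℕ) : Measurable fun ω : D.Limit => ω.toFun n :=
  (measurable_pi_apply n).comp measurable_subtype_coe

theorem map_toFun (ω : D.Limit) {m n : ℕ} (h : m ≤ n) :
    D.map (inclEmb (Finset.range_subset_range.2 h)) (ω.toFun n) = ω.toFun m := by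
  induction n, h using Nat.le_induction with
  | base => exact congrFun (D.map_id _) _
  | succ n h ih =>
    rw [← ih, toFun, toFun, ← ω.2 n, ← Function.comp_apply (f := D.map _), ← D.map_comp]
    rfl

/-- A bound for the values of an embedding of a finite set. -/
def bound {c : Finset ℕ} (e : ↥c ↪ ℕ) : ℕ := Finset.univ.sup e + 1

theorem lt_bound {c : Finset ℕ} (e : ↥c ↪ ℕ) (i : ↥c) : e i < bound e :=
  Nat.lt_succ_of_le (Finset.le_sup (f := e) (Finset.mem_univ i))

/-- The restriction of `ω` along an embedding of a finite set into `ℕ`. -/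
def restr {c : Finset ℕ} (e : ↥c ↪ ℕ) (ω : D.Limit) : D.obj c :=
  D.map (rangeEmb e (bound e) (lt_bound e)) (ω.toFun (bound e))

theorem map_rangeEmb_of_le (ω : D.Limit) {c : Finset ℕ} (e : ↥c ↪ ℕ) {M N : ℕ}
    (hM : ∀ i, e i < M) (hN : ∀ i, e i < N) (h : M ≤ N) :
    D.map (rangeEmb e M hM) (ω.toFun M) = D.map (rangeEmb e N hN) (ω.toFun N) := by
  rw [← ω.map_toFun h, ← Function.comp_apply (f := D.map _), ← D.map_comp]
  rfl

theorem restr_eq (ω : D.Limit) {c : Finset ℕ} (e : ↥c ↪ ℕ) {N : ℕ} (hN : ∀ i, e i < N) :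
    restr e ω = D.map (rangeEmb e N hN) (ω.toFun N) := by
  rcases le_total (bound e) N with h | h
  · exact ω.map_rangeEmb_of_le e _ _ h
  · exact (ω.map_rangeEmb_of_le e _ _ h).symm

theorem map_restr (ω : D.Limit) {b c : Finset ℕ} (τ : ↥b ↪ ↥c) (e : ↥c ↪ ℕ) :
    D.map τ (restr e ω) = restr (τ.trans e) ω := by
  rw [ω.restr_eq (τ.trans e) (fun i => lt_bound e (τ i)), restr,
    ← Function.comp_apply (f := D.map _), ← D.map_comp]
  rfl

theorem measurable_restr {c : Finset ℕ} (e : ↥c ↪ ℕ) :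
    Measurable (restr e : D.Limit → D.obj c) :=
  (D.map_measurable _).comp (measurable_toFun _)

/-- Relabelling of `ω` along an injection of `ℕ`. -/
def act (τ : ℕ ↪ ℕ) (ω : D.Limit) : D.Limit :=
  ⟨fun n => restr ((valEmb (Finset.range n)).trans τ) ω, fun n => by rw [map_restr]; rfl⟩

theorem toFun_act (τ : ℕ ↪ ℕ) (ω : D.Limit) (n : ℕ) :
    (act τ ω).toFun n = restr ((valEmb (Finset.range n)).trans τ) ω := rfl

theorem restr_act (τ : ℕ ↪ ℕ) (ω : D.Limit) {c : Finset ℕ} (e : ↥c ↪ ℕ) :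
    restr e (act τ ω) = restr (e.trans τ) ω := by
  rw [restr, toFun_act, map_restr]
  rfl

theorem act_act (σ τ : ℕ ↪ ℕ) (ω : D.Limit) : act σ (act τ ω) = act (σ.trans τ) ω :=
  Subtype.ext (funext fun _ => restr_act τ ω _)

theorem measurable_act (τ : ℕ ↪ ℕ) : Measurable (act τ : D.Limit → D.Limit) :=
  (measurable_pi_lambda _ fun _ => measurable_restr _).subtype_mk

/-- The sets of infinite structures determined by a finite restriction. -/
def cylinders (D : BDS) : Set (Set D.Limit) :=
  {s | ∃ n, ∃ B : Set (D.obj (Finset.range n)), MeasurableSet B ∧ s = (fun ω => ω.toFun n) ⁻¹' B}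

theorem isPiSystem_cylinders : IsPiSystem (cylinders D) := by
  have lift {m n : ℕ} (h : m ≤ n) {B : Set (D.obj (Finset.range m))} (hB : MeasurableSet B) :
      ∃ B' : Set (D.obj (Finset.range n)), MeasurableSet B' ∧
        (fun ω : D.Limit => ω.toFun m) ⁻¹' B = (fun ω => ω.toFun n) ⁻¹' B' :=
    ⟨_, D.map_measurable (inclEmb (Finset.range_subset_range.2 h)) hB, by
      ext ω
      simp only [Set.mem_preimage, ω.map_toFun h]⟩
  rintro _ ⟨m, B, hB, rfl⟩ _ ⟨n, C, hC, rfl⟩ -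
  obtain ⟨B', hB', hBe⟩ := lift (le_max_left m n) hB
  obtain ⟨C', hC', hCe⟩ := lift (le_max_right m n) hC
  exact ⟨max m n, B' ∩ C', hB'.inter hC', by rw [hBe, hCe]; rfl⟩

theorem generateFrom_cylinders :
    (inferInstance : MeasurableSpace D.Limit) = MeasurableSpace.generateFrom (cylinders D) := by
  apply le_antisymm
  · change MeasurableSpace.comap _ (⨆ n, MeasurableSpace.comap _ _) ≤ _
    rw [MeasurableSpace.comap_iSup]
    refine iSup_le fun n => ?_
    rw [MeasurableSpace.comap_comp]
    rintro _ ⟨B, hB, rfl⟩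
    exact MeasurableSpace.measurableSet_generateFrom ⟨n, B, hB, rfl⟩
  · refine MeasurableSpace.generateFrom_le ?_
    rintro _ ⟨n, B, hB, rfl⟩
    exact measurable_toFun n hB

theorem measure_ext {P Q : Measure D.Limit} [IsProbabilityMeasure P] [IsProbabilityMeasure Q]
    (h : ∀ n, P.map (fun ω => ω.toFun n) = Q.map (fun ω => ω.toFun n)) : P = Q := by
  refine ext_of_generate_finite _ generateFrom_cylinders isPiSystem_cylinders ?_ (by simp)
  rintro _ ⟨n, B, hB, rfl⟩
  rw [← Measure.map_apply (measurable_toFun n) hB, h, Measure.map_apply (measurable_toFun n) hB]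

theorem map_restr_eq {μ : ExchLaw D} {P : Measure D.Limit}
    (hP : ∀ n, P.map (fun ω => ω.toFun n) = μ.law (Finset.range n)) {c : Finset ℕ} (e : ↥c ↪ ℕ) :
    P.map (restr e) = μ.law c := by
  rw [← μ.exch (rangeEmb e (bound e) (lt_bound e)), ← hP,
    Measure.map_map (D.map_measurable _) (measurable_toFun _)]
  rfl

theorem measurePreserving_act {μ : ExchLaw D} {P : Measure D.Limit} [IsProbabilityMeasure P]
    (hP : ∀ n, P.map (fun ω => ω.toFun n) = μ.law (Finset.range n)) (τ : ℕ ↪ ℕ) :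
    MeasurePreserving (act τ) P P := by
  refine ⟨measurable_act τ, ?_⟩
  have := Measure.isProbabilityMeasure_map (μ := P) (measurable_act τ).aemeasurable
  refine measure_ext fun n => ?_
  rw [Measure.map_map (measurable_toFun n) (measurable_act τ), hP]
  exact map_restr_eq hP _

end BDS.Limit

theorem indepFun_eval_of_forall_eq {ι α : Type*} [MeasurableSpace α] {A : (ι → ℝ) → α}
    (hA : Measurable A) (S : Finset ι) (hS : ∀ v w : ι → ℝ, (∀ i ∈ S, v i = w i) → A v = A w)
    {i : ι} (hi : i ∉ S) :
    IndepFun A (fun v => v i) (Measure.infinitePi fun _ : ι => unifMeas) := by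
  classical
  have h := (iIndepFun_infinitePi (P := fun _ : ι => unifMeas) (X := fun _ x => x)
    fun _ => measurable_id).indepFun_finset S {i} (by simpa using hi) fun j => measurable_pi_apply j
  let ext : (↥S → ℝ) → ι → ℝ := fun v j => if hj : j ∈ S then v ⟨j, hj⟩ else 0
  have hext : Measurable ext := measurable_pi_lambda _ fun j => by
    by_cases hj : j ∈ S
    · simpa [ext, hj] using measurable_pi_apply _
    · simp [ext, hj]
  have h' := h.comp (hA.comp hext) (measurable_pi_apply ⟨i, Finset.mem_singleton_self i⟩)
  refine h'.congr (.of_forall fun v => ?_) (.of_forall fun v => rfl)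
  symm
  exact hS _ _ fun j hj => by simp [ext, hj]

theorem ExchLaw.exists_limit {D : BDS} (μ : ExchLaw D) :
    ∃ P : Measure D.Limit, IsProbabilityMeasure P ∧
      ∀ n, P.map (fun ω => ω.toFun n) = μ.law (Finset.range n) := by
  have := μ.prob
  have hne (n : ℕ) : Nonempty (D.obj (Finset.range n)) :=
    nonempty_of_isProbabilityMeasure (μ.law (Finset.range n))
  let r (n : ℕ) : D.obj (Finset.range (n + 1)) → D.obj (Finset.range n) :=
    D.map (inclEmb (Finset.range_subset_range.2 n.le_succ))
  have hr (n : ℕ) : Measurable (r n) := D.map_measurable _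
  obtain ⟨f₀, hf₀, hμ₀⟩ := exists_measurable_map_unifMeas_eq
    (Kernel.const Unit (μ.law (Finset.range 0)))
  choose f hf hμ using fun n => exists_measurable_map_unifMeas_eq
    (condDistrib id (r n) (μ.law (Finset.range (n + 1))))
  let x (v : ℕ → ℝ) (n : ℕ) : D.obj (Finset.range n) :=
    Nat.rec (f₀ () (v 0)) (fun n y => f n y (v (n + 1))) n
  have hx (n : ℕ) : Measurable fun v => x v n := by
    induction n with
    | zero => exact (hf₀.comp measurable_prodMk_left).comp (measurable_pi_apply 0)
    | succ n ih => exact (hf n).comp (ih.prodMk (measurable_pi_apply (n + 1)))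
  have hxd (n : ℕ) : ∀ v w : ℕ → ℝ, (∀ i ∈ Finset.range (n + 1), v i = w i) → x v n = x w n := by
    induction n with
    | zero => exact fun v w h => congrArg (f₀ ()) (h 0 (by simp))
    | succ n ih =>
      intro v w h
      have h1 : x v n = x w n := ih v w fun i hi => h i (by simp at hi ⊢; omega)
      have h2 : v (n + 1) = w (n + 1) := h (n + 1) (by simp)
      change f n (x v n) (v (n + 1)) = f n (x w n) (w (n + 1))
      rw [h1, h2]
  let Q := Measure.infinitePi fun _ : ℕ => unifMeas
  have hstep (n : ℕ) (h : Q.map (fun v => x v n) = μ.law (Finset.range n)) :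
      Q.map (fun v => (x v n, x v (n + 1))) =
        (μ.law (Finset.range (n + 1))).map (fun y => (r n y, y)) := by
    have h1 := map_prodMk_eq_compProd_comap (hx n) (measurable_pi_apply (n + 1))
      (indepFun_eval_of_forall_eq (hx n) _ (hxd n) (i := n + 1) (by simp))
      (Measure.infinitePi_map_eval _ _) (hf n) (hμ n) measurable_id
    refine h1.trans ?_
    rw [h, Kernel.comap_id, ← μ.exch (inclEmb (Finset.range_subset_range.2 n.le_succ))]
    exact compProd_map_condDistrib aemeasurable_id
  have hlaw (n : ℕ) : Q.map (fun v => x v n) = μ.law (Finset.range n) := by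
    induction n with
    | zero =>
      have h0 : Q.map (fun v => v 0) = unifMeas := Measure.infinitePi_map_eval _ _
      have h1 := hμ₀ ()
      have hm : Measurable (f₀ ()) := hf₀.comp measurable_prodMk_left
      rw [← h0, Measure.map_map hm (measurable_pi_apply 0)] at h1
      exact h1
    | succ n ih =>
      have h1 := congrArg (Measure.map Prod.snd) (hstep n ih)
      have hrm : Measurable fun y => (r n y, y) := (hr n).prodMk measurable_id
      rw [Measure.map_map measurable_snd ((hx n).prodMk (hx (n + 1))),
        Measure.map_map measurable_snd hrm] at h1
      exact h1.trans Measure.map_id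
  have hcompat : ∀ᵐ v ∂Q, ∀ n, r n (x v (n + 1)) = x v n := by
    refine ae_all_iff.2 fun n => ?_
    have hm : MeasurableSet {p : D.obj (Finset.range n) × D.obj (Finset.range (n + 1)) |
        r n p.2 = p.1} := measurableSet_eq_fun ((hr n).comp measurable_snd) measurable_fst
    have h1 : ∀ᵐ p ∂(Q.map fun v => (x v n, x v (n + 1))), r n p.2 = p.1 := by
      rw [hstep n (hlaw n)]
      exact (ae_map_iff ((hr n).prodMk measurable_id).aemeasurable hm).2 (.of_forall fun y => rfl)
    exact (ae_map_iff ((hx n).prodMk (hx (n + 1))).aemeasurable hm).1 h1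
  have hxm : Measurable x := measurable_pi_lambda _ hx
  have hms := BDS.Limit.measurableSet_compatible (D := D)
  let P : Measure D.Limit := (Q.map x).comap Subtype.val
  have hP : P.map Subtype.val = Q.map x := by
    exact (map_comap_subtype_coe hms (Q.map x)).trans
      (Measure.restrict_eq_self_of_ae_mem ((ae_map_iff hxm.aemeasurable hms).2 hcompat))
  have hPn (n : ℕ) : P.map (fun ω => ω.toFun n) = μ.law (Finset.range n) := by
    have h1 : P.map (fun ω => ω.toFun n) = (P.map Subtype.val).map (fun y => y n) := by
      rw [Measure.map_map (measurable_pi_apply n) measurable_subtype_coe]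
      rfl
    rw [h1, hP, Measure.map_map (measurable_pi_apply n) hxm]
    exact hlaw n
  refine ⟨P, ⟨?_⟩, hPn⟩
  have h1 := congrArg (fun ν => ν Set.univ) (hPn 0)
  simp only [Measure.map_apply (BDS.Limit.measurable_toFun 0) MeasurableSet.univ, measure_univ,
    Set.preimage_univ] at h1
  exact h1

/-- The increasing enumeration of `s`, continued increasingly beyond `s`. -/
def Finset.enum (s : Finset ℕ) (i : ℕ) : ℕ :=
  if h : i < s.card then s.orderEmbOfFin rfl ⟨i, h⟩ else s.sup id + 1 + i

namespace Finset

theorem enum_eq {s : Finset ℕ} {k i : ℕ} (hk : s.card = k) (h : i < k) :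
    s.enum i = s.orderEmbOfFin hk ⟨i, h⟩ := by
  subst hk
  exact dif_pos h

theorem enum_mem {s : Finset ℕ} {i : ℕ} (h : i < s.card) : s.enum i ∈ s := by
  rw [enum, dif_pos h]
  exact s.orderEmbOfFin_mem rfl _

theorem strictMono_enum (s : Finset ℕ) : StrictMono s.enum := by
  intro i j hij
  by_cases hj : j < s.card
  · rw [enum, enum, dif_pos hj, dif_pos (hij.trans hj)]
    exact (s.orderEmbOfFin rfl).strictMono hij
  · by_cases hi : i < s.card
    · have := Finset.le_sup (f := id) (enum_mem hi)
      rw [id] at this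
      rw [enum.eq_1 s j, dif_neg hj]
      omega
    · rw [enum, enum, dif_neg hj, dif_neg hi]
      omega

theorem image_enum (s : Finset ℕ) : (range s.card).image s.enum = s := by
  refine eq_of_subset_of_card_le (fun x hx => ?_) ?_
  · obtain ⟨i, hi, rfl⟩ := mem_image.1 hx
    exact enum_mem (mem_range.1 hi)
  · rw [card_image_of_injective _ s.strictMono_enum.injective, card_range]

theorem enum_image {s : Finset ℕ} {f : ℕ → ℕ} (hf : StrictMonoOn f s) {i : ℕ} (hi : i < s.card) :
    (s.image f).enum i = f (s.enum i) := by
  have hc : (s.image f).card = s.card := card_image_of_injOn hf.injOn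
  have := orderEmbOfFin_unique (s := s.image f) hc (f := fun j : Fin s.card => f (s.enum j))
    (fun j => mem_image_of_mem f (enum_mem j.2))
    fun j l hjl => hf (enum_mem j.2) (enum_mem l.2) (s.strictMono_enum hjl)
  rw [enum_eq hc hi, ← this]

theorem exists_image_enum_eq {s t : Finset ℕ} (h : t ⊂ s) :
    ∃ u ⊂ range s.card, u.image s.enum = t := by
  classical
  have hu : ((range s.card).filter fun i => s.enum i ∈ t).image s.enum = t := by
    ext x
    simp only [mem_image, mem_filter, mem_range]
    refine ⟨fun ⟨i, hi, hx⟩ => hx ▸ hi.2, fun hx => ?_⟩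
    have hxs := h.1 hx
    rw [← s.image_enum] at hxs
    obtain ⟨i, hi, rfl⟩ := mem_image.1 hxs
    exact ⟨i, ⟨mem_range.1 hi, hx⟩, rfl⟩
  refine ⟨_, (filter_subset _ _).ssubset_of_ne fun he => ?_, hu⟩
  rw [he, image_enum] at hu
  exact h.ne hu.symm

theorem image_enum_ssubset {s u : Finset ℕ} (h : u ⊂ range s.card) : u.image s.enum ⊂ s := by
  conv_rhs => rw [← s.image_enum]
  exact (image_ssubset_image s.strictMono_enum.injective).2 h

end Finset

/-- An embedding of `ℕ` mapping an initial segment onto twice `s` and the rest onto the odd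
numbers. -/
def spareEmb (s : Finset ℕ) : ℕ ↪ ℕ where
  toFun i := if i < s.card then 2 * s.enum i else 2 * (i - s.card) + 1
  inj' i j h := by
    have := s.strictMono_enum.injective.eq_iff (a := i) (b := j)
    simp only [] at h
    split_ifs at h <;> omega

theorem spareEmb_apply (s : Finset ℕ) (i : ℕ) :
    spareEmb s i = if i < s.card then 2 * s.enum i else 2 * (i - s.card) + 1 := rfl

theorem exists_spareEmb_eq_two_mul {s : Finset ℕ} {x : ℕ} (h : x ∈ s) :
    ∃ i, spareEmb s i = 2 * x := by
  rw [← s.image_enum] at h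
  obtain ⟨i, hi, rfl⟩ := Finset.mem_image.1 h
  exact ⟨i, if_pos (Finset.mem_range.1 hi)⟩

theorem exists_spareEmb_eq_two_mul_add_one (s : Finset ℕ) (x : ℕ) :
    ∃ i, spareEmb s i = 2 * x + 1 :=
  ⟨s.card + x, by simp [spareEmb_apply]⟩

theorem exists_trans_eq {f g : ℕ ↪ ℕ} (h : ∀ i, ∃ j, g j = f i) : ∃ ρ : ℕ ↪ ℕ, f = ρ.trans g := by
  choose ρ hρ using h
  refine ⟨⟨ρ, fun i j hij => f.injective ?_⟩, ?_⟩
  · rw [← hρ, ← hρ, hij]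
  · ext i
    exact (hρ i).symm

/-- The extension of the enumeration of `s` fixing the odd numbers. -/
def evenEmb (s : Finset ℕ) : ℕ ↪ ℕ where
  toFun m := if m % 2 = 0 then 2 * s.enum (m / 2) else m
  inj' m l h := by
    have := s.strictMono_enum.injective.eq_iff (a := m / 2) (b := l / 2)
    simp only [] at h
    split_ifs at h <;> omega

theorem spareEmb_trans_evenEmb (s t : Finset ℕ) :
    (spareEmb t).trans (evenEmb s) = spareEmb (t.image s.enum) := by
  have hc := Finset.card_image_of_injective t s.strictMono_enum.injective
  ext i
  change (if spareEmb t i % 2 = 0 then 2 * s.enum (spareEmb t i / 2) else spareEmb t i) = _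
  rw [spareEmb_apply, spareEmb_apply, hc]
  by_cases hi : i < t.card
  · rw [if_pos hi, if_pos hi, Finset.enum_image (s.strictMono_enum.strictMonoOn _) hi]
    simp
  · rw [if_neg hi, if_neg hi, if_neg (by omega)]

/-- An embedding moving everything to odd numbers at least `2 * n`, except for twice the elements
of `s` and the odd numbers less than `2 * n`, which are fixed. -/
def moveEmb (s : Finset ℕ) (n : ℕ) : ℕ ↪ ℕ where
  toFun m := if m % 2 = 0 ∧ m / 2 ∈ s ∨ m % 2 = 1 ∧ m / 2 < n then m else 2 * (n + m) + 1
  inj' m l h := by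
    simp only [] at h
    split_ifs at h <;> omega

theorem moveEmb_spareEmb {s : Finset ℕ} {n i : ℕ} (hi : i < n) :
    moveEmb s n (spareEmb s i) = spareEmb s i := by
  refine if_pos ?_
  rw [spareEmb_apply]
  split_ifs with h
  · have := Finset.enum_mem h
    rw [Nat.mul_div_cancel_left _ two_pos]
    exact .inl ⟨by omega, this⟩
  · omega

theorem exists_spareEmb_trans_moveEmb_eq (s t : Finset ℕ) (n : ℕ) :
    ∃ ρ : ℕ ↪ ℕ, (spareEmb t).trans (moveEmb s n) = ρ.trans (spareEmb (s ∩ t)) := by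
  refine exists_trans_eq fun i => ?_
  change ∃ j, _ = if spareEmb t i % 2 = 0 ∧ spareEmb t i / 2 ∈ s ∨
    spareEmb t i % 2 = 1 ∧ spareEmb t i / 2 < n then spareEmb t i else 2 * (n + spareEmb t i) + 1
  split_ifs with h
  · rw [spareEmb_apply] at h ⊢
    split_ifs at h ⊢ with hi
    · refine exists_spareEmb_eq_two_mul (Finset.mem_inter.2 ⟨?_, Finset.enum_mem hi⟩)
      rw [Nat.mul_div_cancel_left _ two_pos] at h
      exact (h.resolve_right (by omega)).2
    · exact exists_spareEmb_eq_two_mul_add_one _ _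
  · exact exists_spareEmb_eq_two_mul_add_one _ _

/-- The entries of an array with indices in `S`. -/
def mask {Ω : Type*} [Inhabited Ω] (S : Finset (Finset ℕ)) (y : Finset ℕ → Ω) : Finset ℕ → Ω :=
  fun t => if t ∈ S then y t else default

/-- The entries of an array indexed by the proper subsets of `s`, reindexed by the enumeration
of `s`. -/
def boundary {Ω : Type*} [Inhabited Ω] (s : Finset ℕ) (y : Finset ℕ → Ω) : Finset ℕ → Ω :=
  fun t => if t ⊂ Finset.range s.card then y (t.image s.enum) else default

theorem measurable_mask {Ω : Type*} [Inhabited Ω] [MeasurableSpace Ω] (S : Finset (Finset ℕ)) :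
    Measurable (mask S : (Finset ℕ → Ω) → Finset ℕ → Ω) :=
  measurable_pi_lambda _ fun t => by
    unfold mask
    split_ifs
    · exact measurable_pi_apply _
    · exact measurable_const

theorem measurable_boundary {Ω : Type*} [Inhabited Ω] [MeasurableSpace Ω] (s : Finset ℕ) :
    Measurable (boundary s : (Finset ℕ → Ω) → Finset ℕ → Ω) :=
  measurable_pi_lambda _ fun t => by
    unfold boundary
    split_ifs
    · exact measurable_pi_apply _
    · exact measurable_const

theorem boundary_congr {Ω : Type*} [Inhabited Ω] {s : Finset ℕ} {y z : Finset ℕ → Ω}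
    (h : ∀ t ⊂ s, y t = z t) : boundary s y = boundary s z := by
  funext t
  unfold boundary
  split_ifs with ht
  · exact h _ (Finset.image_enum_ssubset ht)
  · rfl

theorem boundary_mask {Ω : Type*} [Inhabited Ω] {S : Finset (Finset ℕ)} {s : Finset ℕ}
    (h : ∀ t ⊂ s, t ∈ S) (y : Finset ℕ → Ω) : boundary s (mask S y) = boundary s y :=
  boundary_congr fun t ht => if_pos (h t ht)

/-- Let `V` have conditional law `κ (g A)` given `g A`. If for every `B` in a generating
`π`-system some measure preserving map fixes the event `V ∈ B` and turns `A` into a function of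
`g A`, then `V` has conditional law `κ (g A)` given `A`. -/
theorem map_prodMk_eq_compProd_comap_of_measurePreserving {Ω α β γ : Type*} [MeasurableSpace α]
    [MeasurableSpace β] [StandardBorelSpace β] [Nonempty β] [MeasurableSpace γ]
    [MeasurableSpace Ω] {P : Measure Ω} [IsProbabilityMeasure P] {A : Ω → α} {V : Ω → β}
    {g : α → γ} (hA : Measurable A) (hV : Measurable V) (hg : Measurable g)
    {κ : Kernel γ β} [IsMarkovKernel κ]
    (hκ : P.map (fun ω => (g (A ω), V ω)) = P.map (fun ω => g (A ω)) ⊗ₘ κ)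
    {C : Set (Set β)} (hC : ‹MeasurableSpace β› = MeasurableSpace.generateFrom C)
    (hCπ : IsPiSystem C)
    (hT : ∀ B ∈ C, ∃ T : Ω → Ω, MeasurePreserving T P P ∧ (∀ ω, V (T ω) ∈ B ↔ V ω ∈ B) ∧
      Measurable[MeasurableSpace.comap (fun ω => g (A ω)) inferInstance] (fun ω => A (T ω))) :
    P.map (fun ω => (A ω, V ω)) = P.map A ⊗ₘ κ.comap g hg := by
  have hb : Measurable fun ω => g (A ω) := hg.comp hA
  have := Measure.isProbabilityMeasure_map (μ := P) hA.aemeasurable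
  have := Measure.isProbabilityMeasure_map (μ := P) (hA.prodMk hV).aemeasurable
  have key (B : Set β) (hB : B ∈ C) (S : Set α) (hS : MeasurableSet S) :
      P (A ⁻¹' S ∩ V ⁻¹' B) = ∫⁻ ω in A ⁻¹' S, κ (g (A ω)) B ∂P := by
    have hBm : MeasurableSet B := hC ▸ MeasurableSpace.measurableSet_generateFrom hB
    obtain ⟨T, hTP, hTB, hTA⟩ := hT B hB
    let W : Ω → ℝ := (V ⁻¹' B).indicator 1
    have hW : MemLp W 2 P := (memLp_const 1).indicator (hV hBm)
    have h1 : P[W | MeasurableSpace.comap A inferInstance] =ᵐ[P]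
        P[W | MeasurableSpace.comap (fun ω => g (A ω)) inferInstance] := by
      refine condExp_ae_eq_of_measurePreserving hTP ?_ hA.comap_le ?_ hW ?_
      · exact (hg.comp (comap_measurable A)).comap_le
      · rw [MeasurableSpace.comap_comp]
        exact hTA.comap_le
      · funext ω
        by_cases h : V ω ∈ B
        · simp [W, h, (hTB ω).2 h]
        · simp [W, h, mt (hTB ω).1 h]
    have h2 := condDistrib_ae_eq_condExp (μ := P) hb hV hBm
    have h3 := ae_of_ae_map hb.aemeasurable
      (condDistrib_ae_eq_of_measure_eq_compProd_of_measurable hb hV hκ)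
    have h4 : (fun ω => (κ (g (A ω))).real B) =ᵐ[P]
        P[W | MeasurableSpace.comap A inferInstance] := by
      filter_upwards [h1, h2, h3] with ω e1 e2 e3
      rw [e1, ← e3, e2]
      rfl
    have h5 : ∫ ω in A ⁻¹' S, W ω ∂P = ∫ ω in A ⁻¹' S, (κ (g (A ω))).real B ∂P := by
      rw [← setIntegral_condExp hA.comap_le (hW.integrable one_le_two) ⟨S, hS, rfl⟩]
      exact setIntegral_congr_ae (hA hS) (h4.mono fun ω h _ => h.symm)
    have h6 : ∫ ω in A ⁻¹' S, W ω ∂P = P.real (A ⁻¹' S ∩ V ⁻¹' B) := by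
      rw [integral_indicator_one (hV hBm), measureReal_restrict_apply (hV hBm), Set.inter_comm]
    have hm : Measurable fun ω => κ (g (A ω)) B := (κ.measurable_coe hBm).comp hb
    have h7 : ∫ ω in A ⁻¹' S, (κ (g (A ω))).real B ∂P
        = (∫⁻ ω in A ⁻¹' S, κ (g (A ω)) B ∂P).toReal :=
      integral_toReal hm.aemeasurable (.of_forall fun ω => measure_lt_top _ _)
    rw [h6, h7] at h5
    refine (ENNReal.toReal_eq_toReal_iff' (measure_ne_top _ _) (ne_top_of_le_ne_top
      (measure_ne_top P (A ⁻¹' S)) ?_)).1 h5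
    calc ∫⁻ ω in A ⁻¹' S, κ (g (A ω)) B ∂P ≤ ∫⁻ ω in A ⁻¹' S, 1 ∂P :=
          lintegral_mono fun ω => prob_le_one
      _ = P (A ⁻¹' S) := by simp
  refine Measure.ext_prod fun {S B} hS hB => ?_
  have hκb : Measurable fun ω => κ (g (A ω)) := κ.measurable.comp hb
  have h : (P.restrict (A ⁻¹' S)).map V = (P.restrict (A ⁻¹' S)).bind fun ω => κ (g (A ω)) := by
    refine ext_of_generate_finite C hC hCπ (fun B hB => ?_) ?_
    · have hBm : MeasurableSet B := hC ▸ MeasurableSpace.measurableSet_generateFrom hB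
      rw [Measure.map_apply hV hBm, Measure.restrict_apply (hV hBm), Set.inter_comm, key B hB S hS,
        Measure.bind_apply hBm hκb.aemeasurable]
    · rw [Measure.map_apply hV .univ, Measure.bind_apply .univ hκb.aemeasurable]
      simp
  have h' := DFunLike.congr_fun h B
  rw [Measure.map_apply hV hB, Measure.restrict_apply (hV hB),
    Measure.bind_apply hB hκb.aemeasurable] at h'
  have hm : Measurable fun x => κ.comap g hg x B := (κ.comap g hg).measurable_coe hB
  rw [Measure.map_apply (hA.prodMk hV) (hS.prod hB), Measure.compProd_apply_prod hS hB,
    setLIntegral_map hS hm hA]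
  rw [Set.inter_comm] at h'
  exact h'

namespace BDS.Limit

variable {D : BDS}

/-- The array of relabellings of `ω` by the embeddings `spareEmb s`. -/
def array (ω : D.Limit) (s : Finset ℕ) : D.Limit := act (spareEmb s) ω

theorem measurable_array : Measurable (array : D.Limit → Finset ℕ → D.Limit) :=
  measurable_pi_lambda _ fun s => measurable_act (spareEmb s)

theorem array_act_evenEmb (ω : D.Limit) (s t : Finset ℕ) :
    array (act (evenEmb s) ω) t = array ω (t.image s.enum) := by
  rw [array, act_act, spareEmb_trans_evenEmb, array]

theorem exists_kernel_array [Inhabited D.Limit] {μ : ExchLaw D} {P : Measure D.Limit}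
    [IsProbabilityMeasure P] (hP : ∀ n, P.map (fun ω => ω.toFun n) = μ.law (Finset.range n)) :
    ∃ κ : ℕ → Kernel (Finset ℕ → D.Limit) D.Limit, (∀ j, IsMarkovKernel (κ j)) ∧
      ∀ s, P.map (fun ω => (boundary s (array ω), array ω s))
        = P.map (fun ω => boundary s (array ω)) ⊗ₘ κ s.card := by
  let b (j : ℕ) (ω : D.Limit) : Finset ℕ → D.Limit := fun t =>
    if t ⊂ Finset.range j then array ω t else default
  have hb (j : ℕ) : Measurable (b j) := measurable_pi_lambda _ fun t => by
    by_cases h : t ⊂ Finset.range j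
    · simp only [b, if_pos h]
      exact measurable_act _
    · simp only [b, if_neg h]
      exact measurable_const
  have hV (s : Finset ℕ) : Measurable fun ω : D.Limit => array ω s := measurable_act _
  refine ⟨fun j => condDistrib (fun ω => array ω (Finset.range j)) (b j) P,
    fun j => inferInstance, fun s => ?_⟩
  have hT := measurePreserving_act hP (evenEmb s)
  have h1 : (fun ω : D.Limit => boundary s (array ω)) = b s.card ∘ act (evenEmb s) := by
    funext ω t
    simp only [boundary, b, Function.comp_apply, array_act_evenEmb]
  have h2 : (fun ω : D.Limit => (boundary s (array ω), array ω s))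
      = (fun ω => (b s.card ω, array ω (Finset.range s.card))) ∘ act (evenEmb s) := by
    funext ω
    refine Prod.ext (congrFun h1 ω) ?_
    simp only [Function.comp_apply, array_act_evenEmb, s.image_enum]
  rw [h1, h2, ← Measure.map_map (hb _) hT.measurable,
    ← Measure.map_map ((hb _).prodMk (hV _)) hT.measurable, hT.map_eq,
    compProd_map_condDistrib (hV _).aemeasurable]

theorem map_mask_array_eq_compProd [Inhabited D.Limit] {μ : ExchLaw D} {P : Measure D.Limit}
    [IsProbabilityMeasure P] (hP : ∀ n, P.map (fun ω => ω.toFun n) = μ.law (Finset.range n))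
    {s : Finset ℕ} {κ : Kernel (Finset ℕ → D.Limit) D.Limit} [IsMarkovKernel κ]
    (hκ : P.map (fun ω => (boundary s (array ω), array ω s))
      = P.map (fun ω => boundary s (array ω)) ⊗ₘ κ)
    {S : Finset (Finset ℕ)} (hS : ∀ t ∈ S, ¬ s ⊆ t) (hsS : ∀ t ⊂ s, t ∈ S) :
    P.map (fun ω => (mask S (array ω), array ω s))
      = P.map (fun ω => mask S (array ω)) ⊗ₘ κ.comap (boundary s) (measurable_boundary s) := by
  have hbm (ω : D.Limit) : boundary s (mask S (array ω)) = boundary s (array ω) :=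
    boundary_mask hsS _
  refine map_prodMk_eq_compProd_comap_of_measurePreserving (A := fun ω => mask S (array ω))
    (V := fun ω => array ω s) ((measurable_mask S).comp measurable_array) (measurable_act _)
    (measurable_boundary s) (by simpa only [hbm] using hκ) generateFrom_cylinders
    isPiSystem_cylinders ?_
  rintro _ ⟨n, B, hB, rfl⟩
  refine ⟨act (moveEmb s n), measurePreserving_act hP _, fun ω => ?_, ?_⟩
  · have h : (valEmb (Finset.range n)).trans ((spareEmb s).trans (moveEmb s n))
        = (valEmb (Finset.range n)).trans (spareEmb s) := by
      ext i
      exact moveEmb_spareEmb (Finset.mem_range.1 i.2)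
    simp only [Set.mem_preimage, array, act_act, toFun_act, h]
  · rw [funext hbm]
    refine @measurable_pi_lambda _ _ _ (_) _ _ fun t => ?_
    unfold mask
    split_ifs with ht
    · obtain ⟨ρ, hρ⟩ := exists_spareEmb_trans_moveEmb_eq s t n
      have hst : s ∩ t ⊂ s := Finset.inter_subset_left.ssubset_of_ne fun h =>
        hS t ht (Finset.inter_eq_left.1 h)
      obtain ⟨u, hu, hus⟩ := Finset.exists_image_enum_eq hst
      have h : (fun ω : D.Limit => array (act (moveEmb s n) ω) t)
          = (fun y => act ρ (y u)) ∘ fun ω => boundary s (array ω) := by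
        funext ω
        simp only [Function.comp_apply, boundary, if_pos hu, hus, array, act_act, hρ]
      rw [h]
      exact ((measurable_act ρ).comp (measurable_pi_apply u)).comp (comap_measurable _)
    · exact measurable_const

end BDS.Limit

section RecArray

variable {Ω : Type*} [Inhabited Ω] (f : ℕ → (Finset ℕ → Ω) → ℝ → Ω)

/-- The array obtained by successively applying `f` to the previously constructed entries and an
array of random seeds. -/
def recArray (v : Finset ℕ → ℝ) (s : Finset ℕ) : Ω :=
  f s.card (fun t => if _h : t ⊂ Finset.range s.card then recArray v (t.image s.enum) else default)
    (v s)
termination_by s.card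
decreasing_by exact Finset.card_lt_card (Finset.image_enum_ssubset _h)

theorem recArray_eq (v : Finset ℕ → ℝ) (s : Finset ℕ) :
    recArray f v s = f s.card (boundary s (recArray f v)) (v s) := by
  rw [recArray]
  rfl

theorem recArray_image {v v' : Finset ℕ → ℝ} {s : Finset ℕ} {ι : ℕ → ℕ} (hι : StrictMonoOn ι s)
    (h : ∀ t ⊆ s, v' t = v (t.image ι)) : recArray f v' s = recArray f v (s.image ι) := by
  induction s using Finset.strongInduction with
  | H s ih =>
    have hc : (s.image ι).card = s.card := Finset.card_image_of_injOn hι.injOn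
    rw [recArray_eq, recArray_eq, hc, h s subset_rfl]
    congr 1
    funext t
    simp only [boundary, hc]
    split_ifs with ht
    · have hs := Finset.image_enum_ssubset ht
      rw [ih _ hs (hι.mono hs.1) fun u hu => h u (hu.trans hs.1), Finset.image_image]
      congr 1
      refine Finset.image_congr fun i hi => ?_
      exact (Finset.enum_image hι (Finset.mem_range.1 (ht.1 hi))).symm
    · rfl

theorem recArray_congr {v v' : Finset ℕ → ℝ} {s : Finset ℕ} (h : ∀ t ⊆ s, v' t = v t) :
    recArray f v' s = recArray f v s := by
  simpa using recArray_image f (ι := id) (strictMono_id.strictMonoOn _) (by simpa using h)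

variable {f}

theorem measurable_recArray [MeasurableSpace Ω] (hf : ∀ j, Measurable (Function.uncurry (f j))) :
    Measurable (recArray f) := by
  refine measurable_pi_lambda _ fun s => ?_
  induction s using Finset.strongInduction with
  | H s ih =>
    simp only [recArray_eq]
    refine (hf s.card).comp (Measurable.prodMk (measurable_pi_lambda _ fun t => ?_)
      (measurable_pi_apply s))
    change Measurable fun v => boundary s (recArray f v) t
    unfold boundary
    split_ifs with ht
    · exact ih _ (Finset.image_enum_ssubset ht)
    · exact measurable_const

theorem mask_insert_eq_update {S : Finset (Finset ℕ)} (s : Finset ℕ) (z : Finset ℕ → Ω) :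
    mask (insert s S) z = Function.update (mask S z) s (z s) := by
  funext t
  by_cases h : t = s
  · subst h
    simp [mask]
  · simp [mask, h]

/-- If `f` codes the conditional laws of the entries of an array given their boundaries, and
entries are conditionally independent given the boundary from those not lying above them, then
`recArray f` has the law of the array. -/
theorem map_mask_recArray_eq [MeasurableSpace Ω] {Ω' : Type*} [MeasurableSpace Ω']
    {P : Measure Ω'} [IsProbabilityMeasure P] {Y : Ω' → Finset ℕ → Ω} (hY : Measurable Y)
    {κ : ℕ → Kernel (Finset ℕ → Ω) Ω} [∀ j, IsMarkovKernel (κ j)]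
    (hf : ∀ j, Measurable (Function.uncurry (f j)))
    (hfκ : ∀ j x, Measure.map (f j x) unifMeas = κ j x)
    (h : ∀ (s : Finset ℕ) (S : Finset (Finset ℕ)), (∀ t ∈ S, ¬ s ⊆ t) → (∀ t ⊂ s, t ∈ S) →
      P.map (fun ω => (mask S (Y ω), Y ω s))
        = P.map (fun ω => mask S (Y ω)) ⊗ₘ (κ s.card).comap (boundary s) (measurable_boundary s))
    {S : Finset (Finset ℕ)} (hS : ∀ s ∈ S, ∀ t ⊆ s, t ∈ S) :
    (Measure.infinitePi fun _ : Finset ℕ => unifMeas).map (fun v => mask S (recArray f v))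
      = P.map fun ω => mask S (Y ω) := by
  induction S using Finset.strongInduction with
  | H S ih =>
    obtain rfl | hne := S.eq_empty_or_nonempty
    · have h0 (y : Finset ℕ → Ω) : mask ∅ y = fun _ => default := funext fun t => if_neg (by simp)
      simp only [h0, Measure.map_const, measure_univ]
    obtain ⟨s, hs, hmax⟩ := S.exists_max_image Finset.card hne
    have hT (t) (ht : t ∈ S.erase s) : ¬ s ⊆ t := fun hst =>
      Finset.ne_of_mem_erase ht
        (Finset.eq_of_subset_of_card_le hst (hmax t (Finset.mem_of_mem_erase ht))).symm
    have hsT (t) (ht : t ⊂ s) : t ∈ S.erase s := Finset.mem_erase.2 ⟨ht.ne, hS s hs t ht.1⟩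
    have hTd (t) (ht : t ∈ S.erase s) (u) (hu : u ⊆ t) : u ∈ S.erase s :=
      Finset.mem_erase.2 ⟨fun h => hT t ht (h ▸ hu), hS t (Finset.mem_of_mem_erase ht) u hu⟩
    have hA : Measurable fun v => mask (S.erase s) (recArray f v) :=
      (measurable_mask _).comp (measurable_recArray hf)
    have hi := indepFun_eval_of_forall_eq hA (S.erase s) (fun v w hvw => by
      funext t
      unfold mask
      split_ifs with ht
      · exact recArray_congr f fun u hu => hvw u (hTd t ht u hu)
      · rfl) (S.notMem_erase s)
    have h1 := map_prodMk_eq_compProd_comap hA (measurable_pi_apply s) hi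
      (Measure.infinitePi_map_eval _ s) (hf s.card) (hfκ s.card) (measurable_boundary s)
    rw [ih _ (Finset.erase_ssubset hs) hTd, ← h s _ hT hsT] at h1
    simp only [boundary_mask hsT, ← recArray_eq] at h1
    have hu : Measurable fun p : (Finset ℕ → Ω) × Ω => Function.update p.1 s p.2 :=
      measurable_update'
    have hYs : Measurable fun ω => (mask (S.erase s) (Y ω), Y ω s) :=
      ((measurable_mask _).comp hY).prodMk ((measurable_pi_apply s).comp hY)
    have hRs : Measurable fun v => (mask (S.erase s) (recArray f v), recArray f v s) :=
      hA.prodMk ((measurable_pi_apply s).comp (measurable_recArray hf))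
    have h2 := congrArg (Measure.map fun p : (Finset ℕ → Ω) × Ω => Function.update p.1 s p.2) h1
    rw [Measure.map_map hu hRs, Measure.map_map hu hYs] at h2
    simpa only [Function.comp_def, ← mask_insert_eq_update, Finset.insert_erase hs] using h2

end RecArray

theorem map_infinitePi_unifMeas {ι ι' : Type*} {g : ι' → ι} (hg : Function.Injective g) :
    (Measure.infinitePi fun _ : ι => unifMeas).map (fun v i => v (g i))
      = Measure.infinitePi fun _ : ι' => unifMeas :=
  Measure.map_infinitePi_infinitePi_of_inj hg

theorem unifRkLaw_eq_infinitePi (k : ℕ) (a : Finset ℕ) :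
    unifRkLaw k a = Measure.infinitePi fun _ : SmallSets a k => unifMeas :=
  (Measure.infinitePi_eq_pi _).symm

instance isProbabilityMeasure_unifRkLaw (k : ℕ) (a : Finset ℕ) :
    IsProbabilityMeasure (unifRkLaw k a) :=
  inferInstanceAs (IsProbabilityMeasure (Measure.pi fun _ : SmallSets a k => unifMeas))

theorem map_unifRkLaw (k : ℕ) {b a : Finset ℕ} (τ : ↥b ↪ ↥a) :
    (unifRkLaw k a).map ((Rk k).map τ) = unifRkLaw k b := by
  rw [unifRkLaw_eq_infinitePi, unifRkLaw_eq_infinitePi]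
  refine map_infinitePi_unifMeas
    (g := fun s : SmallSets b k => (⟨s.1.map τ, by simpa using s.2⟩ : SmallSets a k)) ?_
  intro s t h
  exact Subtype.ext (Finset.map_injective τ (congrArg Subtype.val h))

/-- The position of an element of `s` in the increasing enumeration of `s`. -/
def rankEmb (s : Finset ℕ) : ↥s ↪ ℕ :=
  (s.orderIsoOfFin rfl).symm.toEquiv.toEmbedding.trans Fin.valEmbedding

theorem rankEmb_lt {s : Finset ℕ} (i : ↥s) : rankEmb s i < s.card :=
  ((s.orderIsoOfFin rfl).symm i).2

theorem enum_rankEmb {s : Finset ℕ} (i : ↥s) : s.enum (rankEmb s i) = i := by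
  rw [Finset.enum_eq rfl (rankEmb_lt i)]
  exact congrArg Subtype.val ((s.orderIsoOfFin rfl).apply_symm_apply i)

theorem rankEmb_image {s : Finset ℕ} {ι : ℕ → ℕ} (hι : StrictMonoOn ι s) (i : ↥s) :
    rankEmb (s.image ι) ⟨ι i, Finset.mem_image_of_mem ι i.2⟩ = rankEmb s i := by
  apply (s.image ι).strictMono_enum.injective
  rw [enum_rankEmb, Finset.enum_image hι (rankEmb_lt i), enum_rankEmb]

/-- Multiplication by two, as an embedding. -/
def doubleEmb : ℕ ↪ ℕ := ⟨fun i => 2 * i, fun i j h => by simpa using h⟩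

/-- The subsets of `range n` of cardinality at most `k`. -/
def smallFinsets (n k : ℕ) : Finset (Finset ℕ) :=
  (Finset.range n).powerset.filter fun s => s.card ≤ k

theorem mem_smallFinsets {n k : ℕ} {s : Finset ℕ} :
    s ∈ smallFinsets n k ↔ s ⊆ Finset.range n ∧ s.card ≤ k := by
  simp [smallFinsets]

theorem smallFinsets_downward_closed {n k : ℕ} (s : Finset ℕ) (hs : s ∈ smallFinsets n k)
    (t : Finset ℕ) (ht : t ⊆ s) : t ∈ smallFinsets n k :=
  mem_smallFinsets.2 ⟨ht.trans (mem_smallFinsets.1 hs).1,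
    (Finset.card_le_card ht).trans (mem_smallFinsets.1 hs).2⟩

/-- The elements `x` of `D_{range n}` whose small restrictions are given by the array `z`. -/
def IsAssembly {D : BDS} (k n : ℕ) (z : Finset ℕ → D.Limit) (x : D.obj (Finset.range n)) : Prop :=
  ∀ s (h : s ⊆ Finset.range n), s.card ≤ k →
    D.map (inclEmb h) x = BDS.Limit.restr (rankEmb s) (z s)

section Assembly

variable {D : BDS} {k : ℕ}

theorem isAssembly_congr {n : ℕ} {z z' : Finset ℕ → D.Limit} {x : D.obj (Finset.range n)}
    (h : ∀ s ∈ smallFinsets n k, z s = z' s) : IsAssembly k n z x ↔ IsAssembly k n z' x := by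
  refine forall_congr' fun s => forall_congr' fun hs => forall_congr' fun hk => ?_
  rw [h s (mem_smallFinsets.2 ⟨hs, hk⟩)]

theorem isAssembly_array (k n : ℕ) (ω : D.Limit) :
    IsAssembly k n ω.array (BDS.Limit.restr ((valEmb (Finset.range n)).trans doubleEmb) ω) := by
  intro s h _
  rw [BDS.Limit.map_restr, BDS.Limit.array, BDS.Limit.restr_act]
  congr 1
  ext i
  change 2 * (i : ℕ) = spareEmb s (rankEmb s i)
  rw [spareEmb_apply, if_pos (rankEmb_lt i), enum_rankEmb]

theorem kDetermined.exists_assembly (hdet : kDetermined D k) [Nonempty D.Limit] (n : ℕ) :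
    ∃ G : (Finset ℕ → D.Limit) → D.obj (Finset.range n), Measurable G ∧
      (∀ z z', (∀ s ∈ smallFinsets n k, z s = z' s) → G z = G z') ∧
      ∀ z x, IsAssembly k n z x → G z = x := by
  let I := {s : Finset ℕ // s ⊆ Finset.range n ∧ s.card ≤ k}
  let E : D.obj (Finset.range n) → ∀ s : I, D.obj s.1 := fun x s => D.map (inclEmb s.2.1) x
  have hE : Measurable E := measurable_pi_lambda _ fun s => D.map_measurable _
  have hEi : Function.Injective E := fun x y h =>
    hdet _ x y fun s hs hk => congrFun h ⟨s, hs, hk⟩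
  obtain ⟨L, hL, hLE⟩ := (hE.measurableEmbedding hEi).exists_measurable_extend measurable_id
    fun _ => ⟨(Classical.arbitrary D.Limit).toFun n⟩
  refine ⟨fun z => L fun s => BDS.Limit.restr (rankEmb s.1) (z s.1),
    hL.comp (measurable_pi_lambda _ fun s =>
      (BDS.Limit.measurable_restr _).comp (measurable_pi_apply _)), fun z z' h => ?_,
    fun z x h => ?_⟩
  · refine congrArg L (funext fun s => ?_)
    rw [h s.1 (mem_smallFinsets.2 s.2)]
  · refine Eq.trans ?_ (congrFun hLE x)
    exact congrArg L (funext fun s => (h s.1 s.2.1 s.2.2).symm)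

theorem measurableSet_isAssembly {Ω : Type*} [MeasurableSpace Ω] {n : ℕ}
    {z : Ω → Finset ℕ → D.Limit} {x : Ω → D.obj (Finset.range n)} (hz : Measurable z)
    (hx : Measurable x) : MeasurableSet {v | IsAssembly k n (z v) (x v)} := by
  simp only [IsAssembly, Set.ofPred_forall]
  refine MeasurableSet.iInter fun s => MeasurableSet.iInter fun hs => MeasurableSet.iInter fun _ =>
    measurableSet_eq_fun ((D.map_measurable _).comp hx)
      ((BDS.Limit.measurable_restr _).comp ((measurable_pi_apply s).comp hz))

/-- The restriction of a random seed indexed by finite sets to the small subsets of `range n`. -/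
def restrictSeed (k n : ℕ) (v : Finset ℕ → ℝ) : (Rk k).obj (Finset.range n) :=
  fun s => v (s.1.map (Function.Embedding.subtype _))

/-- The extension by zero of a seed indexed by the small subsets of `range n`. -/
noncomputable def extendSeed (k n : ℕ) (w : (Rk k).obj (Finset.range n)) : Finset ℕ → ℝ :=
  Function.extend (fun s : SmallSets (Finset.range n) k => s.1.map (Function.Embedding.subtype _))
    w 0

theorem injective_map_subtype (k n : ℕ) : Function.Injective
    fun s : SmallSets (Finset.range n) k => s.1.map (Function.Embedding.subtype _) :=
  fun _ _ h => Subtype.ext (Finset.map_injective _ h)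

theorem extendSeed_map (k n : ℕ) (w : (Rk k).obj (Finset.range n))
    (s : SmallSets (Finset.range n) k) :
    extendSeed k n w (s.1.map (Function.Embedding.subtype _)) = w s :=
  (injective_map_subtype k n).extend_apply w 0 s

theorem exists_smallSets_map_eq {n : ℕ} {s : Finset ℕ} (hs : s ∈ smallFinsets n k) :
    ∃ s' : SmallSets (Finset.range n) k, s'.1.map (Function.Embedding.subtype _) = s := by
  obtain ⟨h, hk⟩ := mem_smallFinsets.1 hs
  have he : (s.subtype (· ∈ Finset.range n)).map (Function.Embedding.subtype _) = s := by
    rw [Finset.subtype_map, Finset.filter_true_of_mem h]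
  refine ⟨⟨s.subtype (· ∈ Finset.range n), ?_⟩, he⟩
  rwa [← Finset.card_map, he]

theorem extendSeed_restrictSeed {n : ℕ} (v : Finset ℕ → ℝ) {s : Finset ℕ}
    (hs : s ∈ smallFinsets n k) : extendSeed k n (restrictSeed k n v) s = v s := by
  obtain ⟨s, rfl⟩ := exists_smallSets_map_eq hs
  rw [extendSeed_map]
  rfl

theorem measurable_restrictSeed (k n : ℕ) : Measurable (restrictSeed k n) :=
  measurable_pi_lambda _ fun _ => measurable_pi_apply _

theorem measurable_extendSeed (k n : ℕ) : Measurable (extendSeed k n) := by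
  refine measurable_pi_lambda _ fun s => ?_
  by_cases hs : ∃ s' : SmallSets (Finset.range n) k, s'.1.map (Function.Embedding.subtype _) = s
  · obtain ⟨s, rfl⟩ := hs
    simp only [extendSeed_map]
    exact measurable_pi_apply _
  · have h (w : (Rk k).obj (Finset.range n)) : extendSeed k n w s = 0 :=
      Function.extend_apply' _ _ _ hs
    simp only [h]
    exact measurable_const

theorem map_restrictSeed (k n : ℕ) :
    (Measure.infinitePi fun _ : Finset ℕ => unifMeas).map (restrictSeed k n)
      = unifRkLaw k (Finset.range n) := by
  rw [unifRkLaw_eq_infinitePi]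
  exact map_infinitePi_unifMeas (injective_map_subtype k n)

end Assembly

section OrderedRepresentation

variable {D : BDS} {k : ℕ}

theorem IsAssembly.map [Inhabited D.Limit] {f : ℕ → (Finset ℕ → D.Limit) → ℝ → D.Limit} {m n : ℕ}
    {w : (Rk k).obj (Finset.range n)} {x : D.obj (Finset.range n)}
    (h : IsAssembly k n (recArray f (extendSeed k n w)) x)
    {ι : ↥(Finset.range m) ↪ ↥(Finset.range n)} (hι : StrictMono ι) :
    IsAssembly k m (recArray f (extendSeed k m ((Rk k).map ι w))) (D.map ι x) := by
  intro s hs hk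
  let ι' : ℕ → ℕ := fun i => if hi : i ∈ Finset.range m then ι ⟨i, hi⟩ else i
  have hι'eq (i : ↥(Finset.range m)) : ι' i = ι i := dif_pos i.2
  have hι' : StrictMonoOn ι' s := fun i hi j hj hij => by
    have h : (ι ⟨i, hs hi⟩ : ℕ) < ι ⟨j, hs hj⟩ := hι hij
    rwa [← hι'eq, ← hι'eq] at h
  have hs' : s.image ι' ⊆ Finset.range n := fun j hj => by
    obtain ⟨i, hi, rfl⟩ := Finset.mem_image.1 hj
    rw [hι'eq ⟨i, hs hi⟩]
    exact (ι _).2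
  let τ : ↥s ↪ ↥(s.image ι') := ⟨fun i => ⟨ι' i, Finset.mem_image_of_mem ι' i.2⟩,
    fun i j hij => Subtype.ext (hι'.injOn i.2 j.2 (congrArg Subtype.val hij))⟩
  have hτ : (inclEmb hs).trans ι = τ.trans (inclEmb hs') := by
    ext i
    exact (hι'eq ⟨i, hs i.2⟩).symm
  have hrank : τ.trans (rankEmb (s.image ι')) = rankEmb s := by
    ext i
    exact rankEmb_image hι' i
  have hseed (t : Finset ℕ) (ht : t ⊆ s) :
      extendSeed k m ((Rk k).map ι w) t = extendSeed k n w (t.image ι') := by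
    obtain ⟨t, rfl⟩ := exists_smallSets_map_eq (k := k)
      (mem_smallFinsets.2 ⟨ht.trans hs, (Finset.card_le_card ht).trans hk⟩)
    have himage : (t.1.map (Function.Embedding.subtype _)).image ι'
        = (t.1.map ι).map (Function.Embedding.subtype _) := by
      ext j
      simp only [Finset.mem_image, Finset.mem_map, exists_exists_and_eq_and,
        Function.Embedding.subtype_apply, hι'eq]
    rw [extendSeed_map, himage]
    exact (extendSeed_map k n w ⟨t.1.map ι, by simpa using t.2⟩).symm
  rw [recArray_image f hι' hseed, ← hrank, ← BDS.Limit.map_restr,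
    ← h _ hs' (Finset.card_image_le.trans hk), ← Function.comp_apply (f := D.map _), ← D.map_comp,
    ← Function.comp_apply (f := D.map _), ← D.map_comp, hτ]

/-- A representation of an exchangeable law by uniform seeds which is natural with respect to
strictly increasing maps. -/
theorem ExchLaw.exists_ordered_representation (μ : ExchLaw D) (hdet : kDetermined D k) :
    ∃ F : ∀ n, (Rk k).obj (Finset.range n) → D.obj (Finset.range n), (∀ n, Measurable (F n)) ∧
      (∀ n, (unifRkLaw k (Finset.range n)).map (F n) = μ.law (Finset.range n)) ∧
      ∀ m n (ι : ↥(Finset.range m) ↪ ↥(Finset.range n)), StrictMono ι →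
        ∀ᵐ w ∂unifRkLaw k (Finset.range n), F m ((Rk k).map ι w) = D.map ι (F n w) := by
  obtain ⟨P, _, hP⟩ := μ.exists_limit
  have : Inhabited D.Limit := Classical.inhabited_of_nonempty (nonempty_of_isProbabilityMeasure P)
  obtain ⟨κ, _, hκ⟩ := BDS.Limit.exists_kernel_array hP
  choose f hf hfκ using fun j => exists_measurable_map_unifMeas_eq (κ j)
  choose G hG hGcongr hGeq using fun n => hdet.exists_assembly n
  set Q := Measure.infinitePi fun _ : Finset ℕ => unifMeas
  have hY := BDS.Limit.measurable_array (D := D)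
  have hR := measurable_recArray hf
  have hlaw (n : ℕ) : Q.map (fun v => mask (smallFinsets n k) (recArray f v))
      = P.map fun ω => mask (smallFinsets n k) ω.array :=
    map_mask_recArray_eq hY hf hfκ (fun s S => BDS.Limit.map_mask_array_eq_compProd hP (hκ s))
      smallFinsets_downward_closed
  have hmask (n : ℕ) (z : Finset ℕ → D.Limit) (s) (hs : s ∈ smallFinsets n k) :
      mask (smallFinsets n k) z s = z s := if_pos hs
  have hGmask (n : ℕ) (z : Finset ℕ → D.Limit) : G n (mask (smallFinsets n k) z) = G n z :=
    hGcongr n _ _ (hmask n z)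
  have hGarray (n : ℕ) (ω : D.Limit) := hGeq n _ _ (isAssembly_array k n ω)
  have hYm (n : ℕ) : Measurable fun ω : D.Limit => mask (smallFinsets n k) ω.array :=
    (measurable_mask _).comp hY
  have hRm (n : ℕ) : Measurable fun v => mask (smallFinsets n k) (recArray f v) :=
    (measurable_mask _).comp hR
  have hGQ (n : ℕ) : Q.map (fun v => G n (recArray f v)) = μ.law (Finset.range n) := by
    have h := congrArg (Measure.map (G n)) (hlaw n)
    rw [Measure.map_map (hG n) (hRm n), Measure.map_map (hG n) (hYm n)] at h
    simp only [Function.comp_def, hGmask, hGarray] at h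
    rw [h, BDS.Limit.map_restr_eq hP]
  have hQ (n : ℕ) : ∀ᵐ v ∂Q, IsAssembly k n (recArray f v) (G n (recArray f v)) := by
    have hset : MeasurableSet {z : Finset ℕ → D.Limit | IsAssembly k n z (G n z)} :=
      measurableSet_isAssembly measurable_id (hG n)
    have hmaskiff (z : Finset ℕ → D.Limit) :
        IsAssembly k n (mask (smallFinsets n k) z) (G n (mask (smallFinsets n k) z))
          ↔ IsAssembly k n z (G n z) := by
      rw [hGmask]
      exact isAssembly_congr (hmask n z)
    have h : ∀ᵐ z ∂Q.map (fun v => mask (smallFinsets n k) (recArray f v)),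
        IsAssembly k n z (G n z) := by
      rw [hlaw, ae_map_iff (hYm n).aemeasurable hset]
      refine .of_forall fun ω => ?_
      rw [hmaskiff, hGarray]
      exact isAssembly_array k n ω
    rw [ae_map_iff (hRm n).aemeasurable hset] at h
    simpa only [hmaskiff] using h
  have hseed (n : ℕ) (v : Finset ℕ → ℝ) (s) (hs : s ∈ smallFinsets n k) :
      recArray f (extendSeed k n (restrictSeed k n v)) s = recArray f v s :=
    recArray_congr f fun t ht =>
      extendSeed_restrictSeed v (smallFinsets_downward_closed s hs t ht)
  have hGseed (n : ℕ) (v : Finset ℕ → ℝ) :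
      G n (recArray f (extendSeed k n (restrictSeed k n v))) = G n (recArray f v) :=
    hGcongr n _ _ (hseed n v)
  have hz (n : ℕ) : Measurable fun w => recArray f (extendSeed k n w) :=
    hR.comp (measurable_extendSeed k n)
  have hF (n : ℕ) : Measurable fun w => G n (recArray f (extendSeed k n w)) := (hG n).comp (hz n)
  refine ⟨fun n w => G n (recArray f (extendSeed k n w)), hF, fun n => ?_, fun m n ι hι => ?_⟩
  · rw [← map_restrictSeed, Measure.map_map (hF n) (measurable_restrictSeed k n)]
    simp only [Function.comp_def, hGseed]
    exact hGQ n
  · have h : ∀ᵐ w ∂unifRkLaw k (Finset.range n), IsAssembly k n (recArray f (extendSeed k n w))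
        (G n (recArray f (extendSeed k n w))) := by
      rw [← map_restrictSeed, ae_map_iff (measurable_restrictSeed k n).aemeasurable
        (measurableSet_isAssembly (hz n) (hF n))]
      filter_upwards [hQ n] with v hv
      rw [hGseed]
      exact (isAssembly_congr (hseed n v)).2 hv
    filter_upwards [h] with w hw
    exact hGeq m _ _ (hw.map hι)

end OrderedRepresentation

section Sorting

variable {a : Finset ℕ}

/-- The strict order on `a` by the values of `o`, with ties broken by the order of `ℕ`. -/
def tieBreak (o : ↥a → ℝ) (i j : ↥a) : Prop := o i < o j ∨ o i = o j ∧ i < j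

theorem tieBreak_iff_lt {o : ↥a → ℝ} (ho : Function.Injective o) {i j : ↥a} :
    tieBreak o i j ↔ o i < o j :=
  or_iff_left fun h => h.2.ne (ho h.1)

theorem measurable_tieBreak : Measurable (tieBreak : (↥a → ℝ) → ↥a → ↥a → Prop) := by
  refine measurable_pi_lambda _ fun i => measurable_pi_lambda _ fun j => ?_
  refine measurableSet_setOfPred.1 (MeasurableSet.union ?_ (MeasurableSet.inter ?_ ?_))
  · exact measurableSet_lt (measurable_pi_apply i) (measurable_pi_apply j)
  · exact measurableSet_eq_fun (measurable_pi_apply i) (measurable_pi_apply j)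
  · exact MeasurableSet.const _

theorem exists_equiv_lt_iff_tieBreak (o : ↥a → ℝ) :
    ∃ e : ↥a ≃ ↥(Finset.range a.card), ∀ i j, e i < e j ↔ tieBreak o i j := by
  let key : ↥a ↪ ℝ ×ₗ ↥a := ⟨fun i => toLex (o i, i), fun i j h => (Prod.ext_iff.1 h).2⟩
  have hc : (Finset.univ.map key).card = a.card := by simp
  let r := ((Finset.univ.map key).orderIsoOfFin hc).symm
  have hk (i : ↥a) : key i ∈ Finset.univ.map key := Finset.mem_map_of_mem key (Finset.mem_univ i)
  let e (i : ↥a) : ↥(Finset.range a.card) :=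
    ⟨r ⟨key i, hk i⟩, Finset.mem_range.2 (r ⟨key i, hk i⟩).2⟩
  have he : Function.Bijective e := by
    refine (Fintype.bijective_iff_injective_and_card e).2 ⟨fun i j h => ?_, by simp⟩
    have h' := r.injective (Fin.ext (congrArg Subtype.val h))
    exact key.injective (congrArg Subtype.val h')
  refine ⟨Equiv.ofBijective e he, fun i j => ?_⟩
  have h1 : r ⟨key i, hk i⟩ < r ⟨key j, hk j⟩ ↔ key i < key j := r.lt_iff_lt
  exact h1.trans (Prod.Lex.toLex_lt_toLex)

/-- A bijection onto an initial segment which is increasing for the relation `p`, if it exists. -/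
noncomputable def sortEquiv (p : ↥a → ↥a → Prop) : ↥a ≃ ↥(Finset.range a.card) :=
  open Classical in
  if h : ∃ e : ↥a ≃ ↥(Finset.range a.card), ∀ i j, e i < e j ↔ p i j then h.choose
  else Fintype.equivOfCardEq (by simp)

theorem sortEquiv_tieBreak_lt_iff (o : ↥a → ℝ) (i j : ↥a) :
    sortEquiv (tieBreak o) i < sortEquiv (tieBreak o) j ↔ tieBreak o i j := by
  have h := exists_equiv_lt_iff_tieBreak o
  rw [sortEquiv, dif_pos h]
  exact h.choose_spec i j

end Sorting

/-- A uniform random variable can be split into two independent uniform random variables. -/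
theorem exists_measurePreserving_split_unifMeas :
    ∃ θ : ℝ → ℝ × ℝ, MeasurePreserving θ unifMeas (unifMeas.prod unifMeas) := by
  obtain ⟨f, hf, h⟩ := exists_measurable_map_unifMeas_eq
    (Kernel.const Unit (unifMeas.prod unifMeas))
  exact ⟨f (), hf.comp measurable_prodMk_left, h ()⟩

theorem MeasureTheory.MeasurePreserving.pi_split {θ : ℝ → ℝ × ℝ}
    (hθ : MeasurePreserving θ unifMeas (unifMeas.prod unifMeas)) (k : ℕ) (a : Finset ℕ) :
    MeasurePreserving (fun u : (Rk k).obj a =>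
      ((fun s => (θ (u s)).1, fun s => (θ (u s)).2) : (Rk k).obj a × (Rk k).obj a))
      (unifRkLaw k a) ((unifRkLaw k a).prod (unifRkLaw k a)) :=
  (measurePreserving_arrowProdEquivProdArrow ℝ ℝ (SmallSets a k) (fun _ => unifMeas)
    fun _ => unifMeas).comp (measurePreserving_pi _ _ fun _ => hθ)

theorem ae_ne_unifRkLaw {k : ℕ} {a : Finset ℕ} {s t : SmallSets a k} (hst : s ≠ t) :
    ∀ᵐ v ∂unifRkLaw k a, v s ≠ v t := by
  have hm : Measurable fun v : (Rk k).obj a => (v s, v t) :=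
    (measurable_pi_apply s).prodMk (measurable_pi_apply t)
  have h : (unifRkLaw k a).map (fun v => (v s, v t)) = unifMeas.prod unifMeas := by
    rw [unifRkLaw_eq_infinitePi]
    exact Measure.infinitePi_map_eval_prod hst
  have hd : MeasurableSet {p : ℝ × ℝ | p.1 = p.2} :=
    measurableSet_eq_fun measurable_fst measurable_snd
  have h0 : (unifMeas.prod unifMeas) {p : ℝ × ℝ | p.1 = p.2} = 0 := by
    refine (Measure.measure_prod_null hd).2 (.of_forall fun x => ?_)
    have : Prod.mk x ⁻¹' {p : ℝ × ℝ | p.1 = p.2} = {x} := by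
      ext y
      simp [eq_comm]
    change unifMeas (Prod.mk x ⁻¹' {p : ℝ × ℝ | p.1 = p.2}) = 0
    rw [this]
    exact measure_singleton x
  rw [← h, Measure.map_apply hm hd] at h0
  simp only [ae_iff, not_not, ne_eq]
  exact h0

theorem MeasureTheory.map_uncurry_prod_eq {α β γ : Type*} [MeasurableSpace α] [MeasurableSpace β]
    [MeasurableSpace γ] {P : Measure α} [IsProbabilityMeasure P] {Q : Measure β} [SFinite Q]
    {R : Measure γ} {H : α → β → γ} (hH : Measurable (Function.uncurry H))
    (h : ∀ x, Q.map (H x) = R) : (P.prod Q).map (Function.uncurry H) = R := by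
  ext s hs
  rw [Measure.map_apply hH hs, Measure.prod_apply (hH hs)]
  have h' (x : α) : Q (Prod.mk x ⁻¹' (Function.uncurry H ⁻¹' s)) = R s := by
    have hx : Measurable (H x) := hH.comp measurable_prodMk_left
    rw [← h x, Measure.map_apply hx hs]
    rfl
  simp [h']

theorem measurable_uncurry_comp_of_countable {α β γ P : Type*} [MeasurableSpace α]
    [MeasurableSpace β] [MeasurableSpace γ] [MeasurableSpace P] [Countable P]
    [MeasurableSingletonClass P] {K : P → β → γ} (hK : ∀ p, Measurable (K p)) {p : α → P}
    (hp : Measurable p) : Measurable (Function.uncurry fun v => K (p v)) := by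
  have h1 : Measurable (Function.uncurry K) := measurable_from_prod_countable_right hK
  exact h1.comp ((hp.comp measurable_fst).prodMk measurable_snd)

section SortMap

variable {D : BDS} {k : ℕ}
  (F : ∀ n : ℕ, (Rk k).obj (Finset.range n) → D.obj (Finset.range n))

/-- Sort the indices along `p`, apply `F`, and undo the sorting. -/
noncomputable def sortMap (a : Finset ℕ) (p : ↥a → ↥a → Prop) (w : (Rk k).obj a) : D.obj a :=
  D.map (sortEquiv p).toEmbedding (F a.card ((Rk k).map (sortEquiv p).symm.toEmbedding w))

variable {F}

theorem measurable_sortMap (hF : ∀ n, Measurable (F n)) (a : Finset ℕ) (p : ↥a → ↥a → Prop) :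
    Measurable (sortMap F a p) :=
  (D.map_measurable _).comp ((hF _).comp ((Rk k).map_measurable _))

theorem ExchLaw.map_sortMap (μ : ExchLaw D) (hF : ∀ n, Measurable (F n))
    (hFμ : ∀ n, (unifRkLaw k (Finset.range n)).map (F n) = μ.law (Finset.range n))
    (a : Finset ℕ) (p : ↥a → ↥a → Prop) :
    (unifRkLaw k a).map (sortMap F a p) = μ.law a := by
  have h1 : Measurable ((Rk k).map (sortEquiv p).symm.toEmbedding) := (Rk k).map_measurable _
  rw [← μ.exch (sortEquiv p).toEmbedding, ← hFμ,
    ← map_unifRkLaw k (sortEquiv p).symm.toEmbedding, Measure.map_map (hF _) h1,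
    Measure.map_map (D.map_measurable _) ((hF _).comp h1)]
  rfl

theorem sortMap_map {a b : Finset ℕ} (τ : ↥b ↪ ↥a) {o : ↥a → ℝ} (ho : Function.Injective o)
    {w : (Rk k).obj a}
    (hw : ∀ (e : ↥a ≃ ↥(Finset.range a.card)) (ι : ↥(Finset.range b.card) ↪ ↥(Finset.range a.card)),
      StrictMono ι → F b.card ((Rk k).map ι ((Rk k).map e.symm.toEmbedding w))
        = D.map ι (F a.card ((Rk k).map e.symm.toEmbedding w))) :
    sortMap F b (tieBreak (o ∘ τ)) ((Rk k).map τ w) = D.map τ (sortMap F a (tieBreak o) w) := by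
  unfold sortMap
  have hlt := sortEquiv_tieBreak_lt_iff o
  have hlt' := sortEquiv_tieBreak_lt_iff (o ∘ τ)
  generalize sortEquiv (tieBreak o) = e at hlt ⊢
  generalize sortEquiv (tieBreak (o ∘ τ)) = e' at hlt' ⊢
  let ι := e'.symm.toEmbedding.trans (τ.trans e.toEmbedding)
  have hι : StrictMono ι := fun x y hxy => by
    rw [← e'.apply_symm_apply x, ← e'.apply_symm_apply y, hlt',
      tieBreak_iff_lt (ho.comp τ.injective)] at hxy
    exact (hlt _ _).2 ((tieBreak_iff_lt ho).2 hxy)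
  have h1 : e'.symm.toEmbedding.trans τ = ι.trans e.symm.toEmbedding := by
    ext x
    simp [ι]
  have h2 : e'.toEmbedding.trans ι = τ.trans e.toEmbedding := by
    ext x
    simp [ι]
  rw [← Function.comp_apply (f := (Rk k).map _), ← (Rk k).map_comp, h1, (Rk k).map_comp,
    Function.comp_apply, hw e ι hι, ← Function.comp_apply (f := D.map _), ← D.map_comp, h2,
    D.map_comp, Function.comp_apply]

theorem ae_forall_strictMono_map_eq
    (hFnat : ∀ m n (ι : ↥(Finset.range m) ↪ ↥(Finset.range n)), StrictMono ι →
      ∀ᵐ w ∂unifRkLaw k (Finset.range n), F m ((Rk k).map ι w) = D.map ι (F n w))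
    (a : Finset ℕ) (m : ℕ) :
    ∀ᵐ w ∂unifRkLaw k a, ∀ (e : ↥a ≃ ↥(Finset.range a.card))
      (ι : ↥(Finset.range m) ↪ ↥(Finset.range a.card)), StrictMono ι →
      F m ((Rk k).map ι ((Rk k).map e.symm.toEmbedding w))
        = D.map ι (F a.card ((Rk k).map e.symm.toEmbedding w)) := by
  simp only [ae_all_iff]
  intro e ι hι
  have h := hFnat _ _ ι hι
  rw [← map_unifRkLaw k e.symm.toEmbedding] at h
  exact ae_of_ae_map ((Rk k).map_measurable e.symm.toEmbedding).aemeasurable h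

end SortMap

/-- The representation theorem in positive depth: sort the indices by auxiliary seeds attached to
the singletons, and apply a representation which is natural for strictly increasing maps. -/
theorem ExchLaw.exists_representation_of_pos {D : BDS} {k : ℕ} (hk : 0 < k) (μ : ExchLaw D)
    (hdet : kDetermined D k) :
    ∃ η : ASNatTrans (Rk k) D (unifRkLaw k),
      ∀ a : Finset ℕ, Measure.map (η.app a) (unifRkLaw k a) = μ.law a := by
  obtain ⟨F, hF, hFμ, hFnat⟩ := μ.exists_ordered_representation hdet
  obtain ⟨θ, hθ⟩ := exists_measurePreserving_split_unifMeas
  let O (a : Finset ℕ) (v : (Rk k).obj a) (i : ↥a) : ℝ :=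
    v ⟨{i}, (Finset.card_singleton i).trans_le hk⟩
  have hO (a : Finset ℕ) : Measurable (O a) := measurable_pi_lambda _ fun _ => measurable_pi_apply _
  let H (a : Finset ℕ) (v w : (Rk k).obj a) : D.obj a := sortMap F a (tieBreak (O a v)) w
  have hH (a : Finset ℕ) : Measurable (Function.uncurry (H a)) :=
    measurable_uncurry_comp_of_countable (measurable_sortMap hF a) (measurable_tieBreak.comp (hO a))
  let fst (a : Finset ℕ) (u : (Rk k).obj a) : (Rk k).obj a := fun s => (θ (u s)).1
  let snd (a : Finset ℕ) (u : (Rk k).obj a) : (Rk k).obj a := fun s => (θ (u s)).2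
  have hsplit (a : Finset ℕ) : MeasurePreserving (fun u => (fst a u, snd a u)) (unifRkLaw k a)
      ((unifRkLaw k a).prod (unifRkLaw k a)) := hθ.pi_split k a
  have hfst (a : Finset ℕ) : MeasurePreserving (fst a) (unifRkLaw k a) (unifRkLaw k a) :=
    measurePreserving_fst.comp (hsplit a)
  have hsnd (a : Finset ℕ) : MeasurePreserving (snd a) (unifRkLaw k a) (unifRkLaw k a) :=
    measurePreserving_snd.comp (hsplit a)
  refine ⟨⟨fun a => Function.uncurry (H a) ∘ fun u => (fst a u, snd a u),
    fun a => (hH a).comp (hsplit a).measurable, fun {b a} τ => ?_⟩, fun a => ?_⟩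
  · have hinj : ∀ᵐ u ∂unifRkLaw k a, ∀ i j, i ≠ j → O a (fst a u) i ≠ O a (fst a u) j := by
      simp only [ae_all_iff]
      refine fun i j hij => (hfst a).quasiMeasurePreserving.ae (ae_ne_unifRkLaw fun h => hij ?_)
      simpa using h
    filter_upwards [hinj, (hsnd a).quasiMeasurePreserving.tendsto_ae.eventually
      (ae_forall_strictMono_map_eq hFnat a b.card)] with u hu hn
    have ho : Function.Injective (O a (fst a u)) := fun i j h => not_imp_not.1 (hu i j) h
    have hob : O b (fst b ((Rk k).map τ u)) = O a (fst a u) ∘ τ := by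
      funext i
      simp only [O, fst, Rk, Finset.map_singleton, Function.comp_apply]
    have h := sortMap_map τ ho hn
    rw [← hob] at h
    exact h
  · have h := map_uncurry_prod_eq (P := unifRkLaw k a) (hH a) fun v => μ.map_sortMap hF hFμ a _
    rwa [← (hsplit a).map_eq, Measure.map_map (hH a) (hsplit a).measurable] at h

/-- The representation theorem in depth zero: each `D_a` embeds into the space `D_∅`. -/
theorem ExchLaw.exists_representation_zero {D : BDS} (μ : ExchLaw D) (hdet : kDetermined D 0) :
    ∃ η : ASNatTrans (Rk 0) D (unifRkLaw 0),
      ∀ a : Finset ℕ, Measure.map (η.app a) (unifRkLaw 0 a) = μ.law a := by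
  have := μ.prob
  have hne (a : Finset ℕ) : Nonempty (D.obj a) := nonempty_of_isProbabilityMeasure (μ.law a)
  obtain ⟨g, hg, hgμ⟩ := exists_measurable_map_unifMeas_eq (Kernel.const Unit (μ.law ∅))
  let res (a : Finset ℕ) : D.obj a → D.obj ∅ := D.map (inclEmb (Finset.empty_subset a))
  have hres (a : Finset ℕ) : Measurable (res a) := D.map_measurable _
  have hresμ (a : Finset ℕ) : (μ.law a).map (res a) = μ.law ∅ := μ.exch _
  have hinj (a : Finset ℕ) : Function.Injective (res a) := fun x y hxy =>
    hdet a x y fun a' h h0 => by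
      obtain rfl := Finset.card_eq_zero.1 (Nat.le_zero.1 h0)
      exact hxy
  have hemb (a : Finset ℕ) : MeasurableEmbedding (res a) := (hres a).measurableEmbedding (hinj a)
  have hL (a : Finset ℕ) : ∃ L : D.obj ∅ → D.obj a, Measurable L ∧ L ∘ res a = id :=
    (hemb a).exists_measurable_extend measurable_id fun _ => hne a
  choose L hLm hL using hL
  have hLae (a : Finset ℕ) : ∀ᵐ y ∂μ.law ∅, res a (L a y) = y := by
    rw [← hresμ a, (hemb a).ae_map_iff]
    exact Filter.Eventually.of_forall fun x => congrArg (res a) (congrFun (hL a) x)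
  let f (a : Finset ℕ) (u : (Rk 0).obj a) : D.obj ∅ := g () (u ⟨∅, le_rfl⟩)
  have hf (a : Finset ℕ) : MeasurePreserving (f a) (unifRkLaw 0 a) (μ.law ∅) :=
    MeasurePreserving.comp ⟨hg.comp measurable_prodMk_left, hgμ ()⟩
      (measurePreserving_eval (fun _ : SmallSets a 0 => unifMeas) ⟨∅, le_rfl⟩)
  refine ⟨⟨fun a => L a ∘ f a, fun a => (hLm a).comp (hf a).measurable, fun {b a} τ => ?_⟩,
    fun a => ?_⟩
  · filter_upwards [(hf a).quasiMeasurePreserving.ae (hLae a),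
      (hf a).quasiMeasurePreserving.ae (hLae b)] with u ha hb
    refine hinj b ?_
    have h : (inclEmb (Finset.empty_subset b)).trans τ = inclEmb (Finset.empty_subset a) :=
      Subsingleton.elim _ _
    have hf' : f b ((Rk 0).map τ u) = f a u := rfl
    have h' : res b (D.map τ (L a (f a u))) = res a (L a (f a u)) := by
      simp only [res, ← h, D.map_comp, Function.comp_apply]
    rw [Function.comp_apply, Function.comp_apply, h', hf', ha, hb]
  · rw [← Measure.map_map (hLm a) (hf a).measurable, (hf a).map_eq, ← hresμ a,
      Measure.map_map (hLm a) (hres a), hL, Measure.map_id]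

/-- Weak functional representation theorem with finite depth: if `depth(D) = k`
(i.e. `k` is the least level of determination of `D`), then every exchangeable law
`μ` on `D` is the pushforward of `unif(R^k)` under a `unif(R^k)`-almost-sure
natural transformation `η : R^k → D`. -/
theorem weak_functional_representation_finite_depth
    (D : BDS) (k : ℕ) (hdet : kDetermined D k)
    (hleast : ∀ j : ℕ, kDetermined D j → k ≤ j)
    (μ : ExchLaw D) :
    ∃ η : ASNatTrans (Rk k) D (unifRkLaw k),
      ∀ a : Finset ℕ, Measure.map (η.app a) (unifRkLaw k a) = μ.law a := by
  rcases Nat.eq_zero_or_pos k with rfl | hk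
  · exact μ.exists_representation_zero hdet
  · exact μ.exists_representation_of_pos hk hdet
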